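/- Let α, β, γ ∈ C and consider the hypergeometric operator L = D^2 + a_1 D + a_0 with a_1 = ((α+β+1)x - γ)/(x(x-1)) and a_0 = αβ/(x(x-1)), whose adjoint acts on C(x) by L*(r) = r'' - (a_1·r)' + a_0·r. If neither α - 1 nor β - 1 is a nonnegative integer, then L is stable; in fact, for every integer s ≥ 0 one has L*(x^{s+1}(x-1)) = (s+1-α)(s+1-β) x^s - s(s+1-γ) x^{s-1}, a polynomial of degree s. -/

import Mathlib

open Polynomial

/-- The derivative of a rational function, computed via the quotient rule on the
reduced numerator/denominator representation. -/
noncomputable def rderiv {C : Type} [Field C] (f : RatFunc C) : RatFunc C :=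
  algebraMap (Polynomial C) (RatFunc C)
      (derivative f.num * f.denom - f.num * derivative f.denom) /
    algebraMap (Polynomial C) (RatFunc C) (f.denom ^ 2)

/-- The adjoint of the hypergeometric operator `L = D² + a₁ D + a₀` with
`a₁ = ((α+β+1)x - γ)/(x(x-1))` and `a₀ = αβ/(x(x-1))`, applied to `r`:
`L*(r) = r'' - (a₁ r)' + a₀ r`. -/
noncomputable def adjHyp {C : Type} [Field C] (α β γ : C) (r : RatFunc C) : RatFunc C :=
  rderiv (rderiv r) -
    rderiv (((RatFunc.C (α + β + 1) * RatFunc.X - RatFunc.C γ) /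
        (RatFunc.X * (RatFunc.X - 1))) * r) +
    (RatFunc.C (α * β) / (RatFunc.X * (RatFunc.X - 1))) * r

/-- A linear differential operator with adjoint action `adj` on `C(x)` is stable if for
every `i ≥ 0` there is a polynomial of degree `i` in the image of the adjoint on `C(x)`. -/
def stableOf {C : Type} [Field C] (adj : RatFunc C → RatFunc C) : Prop :=
  ∀ i : ℕ, ∃ p : Polynomial C, p.degree = (i : ℕ) ∧
    ∃ r : RatFunc C, adj r = algebraMap (Polynomial C) (RatFunc C) p

/-- On polynomials, `rderiv` is the usual derivative. -/
theorem rderiv_algebraMap {K : Type} [Field K] (p : K[X]) :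
    rderiv (algebraMap K[X] (RatFunc K) p) = algebraMap K[X] (RatFunc K) (derivative p) := by
  simp [rderiv]

theorem adjHyp_algebraMap_X_mul_X_sub_one_mul {K : Type} [Field K] (α β γ : K) (q : K[X]) :
    adjHyp α β γ (algebraMap K[X] (RatFunc K) (X * (X - 1) * q)) =
      algebraMap K[X] (RatFunc K) (derivative (derivative (X * (X - 1) * q)) -
        derivative ((C (α + β + 1) * X - C γ) * q) + C (α * β) * q) := by
  have hX : (RatFunc.X : RatFunc K) ≠ 0 := RatFunc.X_ne_zero
  have hX1 : (RatFunc.X - 1 : RatFunc K) ≠ 0 := by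
    rw [← RatFunc.algebraMap_X, ← map_one (algebraMap K[X] (RatFunc K)), ← map_sub]
    exact RatFunc.algebraMap_ne_zero (by simpa using X_sub_C_ne_zero (1 : K))
  have h (a : RatFunc K) : a / (RatFunc.X * (RatFunc.X - 1)) *
      algebraMap K[X] (RatFunc K) (X * (X - 1) * q) = a * algebraMap K[X] (RatFunc K) q := by
    simp only [map_mul, map_sub, map_one, RatFunc.algebraMap_X]
    field_simp
  have h₁ : (RatFunc.C (α + β + 1) * RatFunc.X - RatFunc.C γ) * algebraMap K[X] (RatFunc K) q =
      algebraMap K[X] (RatFunc K) ((C (α + β + 1) * X - C γ) * q) := by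
    simp only [map_mul, map_sub, RatFunc.algebraMap_X, RatFunc.algebraMap_C]
  rw [adjHyp, h, h, h₁, rderiv_algebraMap, rderiv_algebraMap, rderiv_algebraMap,
    map_add (algebraMap K[X] (RatFunc K)), map_sub, map_mul _ (C (α * β)), RatFunc.algebraMap_C]

theorem adjHyp_X_pow_succ_mul {K : Type} [Field K] (α β γ : K) (s : ℕ) :
    adjHyp α β γ (RatFunc.X ^ (s + 1) * (RatFunc.X - 1)) =
      algebraMap K[X] (RatFunc K) (C (((s : K) + 1 - α) * ((s : K) + 1 - β)) * X ^ s -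
        C ((s : K) * ((s : K) + 1 - γ)) * X ^ (s - 1)) := by
  have h : (RatFunc.X ^ (s + 1) * (RatFunc.X - 1) : RatFunc K) =
      algebraMap K[X] (RatFunc K) (X * (X - 1) * X ^ s) := by
    simp only [map_mul, map_sub, map_one, map_pow, RatFunc.algebraMap_X]
    ring
  rw [h, adjHyp_algebraMap_X_mul_X_sub_one_mul]
  congr 1
  rcases s with _ | _ | s
  · simp
    ring
  · simp
    ring
  · simp
    ring

/-- Example 3.3. If neither `α - 1` nor `β - 1` is a nonnegative
integer, then the hypergeometric operator is stable; in fact for every `s ≥ 0`,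
`L*(x^{s+1}(x-1)) = (s+1-α)(s+1-β) x^s - s(s+1-γ) x^{s-1}`. -/
theorem hypergeometric_operator_stable {C : Type} [Field C] [IsAlgClosed C] [CharZero C]
    (α β γ : C) (hα : ∀ n : ℕ, α - 1 ≠ (n : C)) (hβ : ∀ n : ℕ, β - 1 ≠ (n : C)) :
    (∀ s : ℕ, adjHyp α β γ (RatFunc.X ^ (s + 1) * (RatFunc.X - 1)) =
        RatFunc.C (((s : C) + 1 - α) * ((s : C) + 1 - β)) * RatFunc.X ^ s -
          RatFunc.C ((s : C) * ((s : C) + 1 - γ)) * (RatFunc.X ^ s / RatFunc.X)) ∧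
    stableOf (adjHyp α β γ) := by
  refine ⟨fun s => ?_, fun s => ⟨_, ?_, _, adjHyp_X_pow_succ_mul α β γ s⟩⟩
  · rw [adjHyp_X_pow_succ_mul]
    rcases s with _ | s
    · simp
    · have hX : (RatFunc.X : RatFunc C) ≠ 0 := RatFunc.X_ne_zero
      rw [pow_succ RatFunc.X s, mul_div_cancel_right₀ _ hX]
      simp only [map_sub, map_mul, map_pow, RatFunc.algebraMap_X, RatFunc.algebraMap_C,
        Nat.add_sub_cancel, pow_succ]
  · have hne : ((s : C) + 1 - α) * ((s : C) + 1 - β) ≠ 0 :=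
      mul_ne_zero (fun h => hα s (by linear_combination -h))
        (fun h => hβ s (by linear_combination -h))
    rcases s with _ | s
    · simpa using degree_C hne
    · rw [degree_sub_eq_left_of_degree_lt, degree_C_mul_X_pow _ hne]
      rw [degree_C_mul_X_pow _ hne]
      refine (degree_C_mul_X_pow_le _ _).trans_lt ?_
      exact_mod_cast Nat.lt_succ_self s
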